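/- arXiv:2312.01443 — 6 statements merged into one kernel-verified Lean document; each statement's English description precedes it below -/
import Mathlib

section
/- Let D be a finite abelian group with a non-degenerate quadratic form q: D → ℚ/ℤ, of exponent a power of a prime p. If D contains an isotropic subgroup H isomorphic to (ℤ/pℤ)^3, then for every γ ∈ D the orthogonal complement γ^⊥ (with respect to the bilinear form b(x,y)=q(x+y)−q(x)−q(y)) contains an isotropic subgroup isomorphic to (ℤ/pℤ)^2. -/
open scoped Classical BigOperators

noncomputable section

/-- The bilinear form associated to a quadratic form `q : D → ℚ/ℤ`. -/
def bil {D : Type*} [AddCommGroup D] (q : D → AddCircle (1 : ℚ)) (x y : D) :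
    AddCircle (1 : ℚ) :=
  q (x + y) - q x - q y

/-- A linear functional on a three-dimensional space vanishes on a two-dimensional subspace. -/
theorem exists_injective_prod_ker {k : Type*} [Field k] (g : k × k × k →ₗ[k] k) :
    ∃ s : k × k →ₗ[k] k × k × k, Function.Injective s ∧ ∀ v, g (s v) = 0 := by
  have hle : Module.finrank k (k × k) ≤ Module.finrank k (LinearMap.ker g) := by
    have h := g.finrank_range_add_finrank_ker
    have hr := (LinearMap.range g).finrank_le
    simp only [Module.finrank_prod, Module.finrank_self] at h hr ⊢
    omega
  obtain ⟨s, hs⟩ := finrank_le_iff_exists_linearMap.mp hle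
  exact ⟨(LinearMap.ker g).subtype ∘ₗ s, Subtype.val_injective.comp hs, fun v => (s v).2⟩

/-- The `n`-torsion of `ℚ/ℤ` is contained in the image of one homomorphism from `ℤ/n`. -/
theorem exists_zmod_hom_torsion (n : ℕ) [NeZero n] :
    ∃ ι : ZMod n →+ AddCircle (1 : ℚ), ∀ t, n • t = 0 → ∃ a, ι a = t := by
  have hu : n • ((1 / n : ℚ) : AddCircle (1 : ℚ)) = 0 := by
    rw [← AddCircle.coe_nsmul, nsmul_eq_mul, mul_one_div_cancel (NeZero.ne _)]
    exact AddCircle.coe_period 1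
  refine ⟨ZMod.lift n ⟨zmultiplesHom _ ((1 / n : ℚ) : AddCircle (1 : ℚ)), by simpa using hu⟩, ?_⟩
  intro t ht
  obtain ⟨m, -, rfl⟩ := (AddCircle.nsmul_eq_zero_iff (NeZero.pos n)).mp ht
  refine ⟨((m : ℤ) : ZMod n), ?_⟩
  rw [ZMod.lift_coe]
  change (m : ℤ) • ((1 / n : ℚ) : AddCircle (1 : ℚ)) = _
  rw [natCast_zsmul, ← AddCircle.coe_nsmul, nsmul_eq_mul, mul_one_div, mul_one]

/-- A homomorphism from `(ℤ/p)³` to `ℚ/ℤ` vanishes on a copy of `(ℤ/p)²`. -/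
theorem exists_injective_hom_comp_eq_zero (p : ℕ) [Fact p.Prime]
    (f : ZMod p × ZMod p × ZMod p →+ AddCircle (1 : ℚ)) :
    ∃ s : ZMod p × ZMod p →+ ZMod p × ZMod p × ZMod p,
      Function.Injective s ∧ ∀ v, f (s v) = 0 := by
  obtain ⟨ι, hι⟩ := exists_zmod_hom_torsion p
  have htor (v : ZMod p × ZMod p × ZMod p) : p • f v = 0 := by
    rw [← map_nsmul]
    have : p • v = 0 := by ext <;> simp
    rw [this, map_zero]
  obtain ⟨a, ha⟩ := hι _ (htor (1, 0, 0))
  obtain ⟨b, hb⟩ := hι _ (htor (0, 1, 0))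
  obtain ⟨c, hc⟩ := hι _ (htor (0, 0, 1))
  have hsmul (x r : ZMod p) (w : ZMod p × ZMod p × ZMod p) (h : ι r = f w) :
      f (x • w) = ι (x * r) := by
    obtain ⟨k, rfl⟩ := ZMod.intCast_surjective x
    rw [Int.cast_smul_eq_zsmul, map_zsmul, ← zsmul_eq_mul, map_zsmul, h]
  let m (r : ZMod p) : ZMod p →ₗ[ZMod p] ZMod p := LinearMap.toSpanSingleton _ _ r
  let g := (m a).coprod ((m b).coprod (m c))
  have hfg : f = ι.comp g.toAddMonoidHom := by
    ext ⟨x, y, z⟩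
    have hv : (x, y, z) =
        x • ((1, 0, 0) : ZMod p × ZMod p × ZMod p) + (y • (0, 1, 0) + z • (0, 0, 1)) := by
      simp
    rw [hv, map_add, map_add, hsmul x a _ ha, hsmul y b _ hb, hsmul z c _ hc]
    simp [g, m]
  obtain ⟨s, hs, hgs⟩ := exists_injective_prod_ker g
  refine ⟨s.toAddMonoidHom, hs, fun v => ?_⟩
  simp [hfg, hgs]

/-- Let `D` be a finite abelian group with a non-degenerate quadratic form
`q : D → ℚ/ℤ`, of exponent a power of a prime `p`.  If `D` contains an isotropic
subgroup `H` isomorphic to `(ℤ/pℤ)³`, then for every `γ ∈ D` the orthogonal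
complement `γ^⊥` contains an isotropic subgroup isomorphic to `(ℤ/pℤ)²`. -/
theorem isotropic_rank_two_in_perp_of_rank_three
    {D : Type*} [AddCommGroup D] [Fintype D] (p : ℕ) (hp : p.Prime)
    (q : D → AddCircle (1 : ℚ))
    (hquad : ∀ (n : ℤ) (x : D), q (n • x) = (n ^ 2 : ℤ) • q x)
    (hbil : ∀ x y z : D, bil q (x + y) z = bil q x z + bil q y z)
    (hnd : ∀ x : D, (∀ y : D, bil q x y = 0) → x = 0)
    (hexp : ∃ k : ℕ, ∀ x : D, p ^ k • x = 0)
    (H : AddSubgroup D) (hiso : ∀ x ∈ H, q x = 0)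
    (hH3 : Nonempty (H ≃+ (ZMod p × ZMod p × ZMod p))) :
    ∀ γ : D, ∃ K : AddSubgroup D, (∀ x ∈ K, q x = 0) ∧
      (∀ x ∈ K, bil q γ x = 0) ∧ Nonempty (K ≃+ (ZMod p × ZMod p)) := by
  intro γ
  obtain ⟨e⟩ := hH3
  have := Fact.mk hp
  have hcomm (x y : D) : bil q x y = bil q y x := by
    simp only [bil, add_comm x y]; abel
  let B : D →+ AddCircle (1 : ℚ) := AddMonoidHom.mk' (fun x => bil q x γ) fun x y => hbil x y γ
  let i : ZMod p × ZMod p × ZMod p →+ D := H.subtype.comp e.symm.toAddMonoidHom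
  have hi : Function.Injective i := Subtype.val_injective.comp e.symm.injective
  obtain ⟨s, hs, hBs⟩ := exists_injective_hom_comp_eq_zero p (B.comp i)
  refine ⟨(i.comp s).range, ?_, ?_, ⟨(AddMonoidHom.ofInjective (f := i.comp s) (hi.comp hs)).symm⟩⟩
  · rintro _ ⟨v, rfl⟩
    exact hiso _ (e.symm (s v)).2
  · rintro _ ⟨v, rfl⟩
    rw [hcomm]
    exact hBs v
end
end

section
/- Let D be a finite abelian group with non-degenerate quadratic form of exponent a power of a prime p. Let 𝓗 be the set of all nontrivial isotropic subgroups of D and 𝓗' the subset of those of order p. Then the sum of the images Σ_{H∈𝓗} im(↑_H) equals Σ_{H∈𝓗'} im(↑_H), and the intersection of kernels ∩_{H∈𝓗} ker(↓_H) equals ∩_{H∈𝓗'} ker(↓_H). -/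
open scoped Classical BigOperators

noncomputable section

/-- `↑_H(e^{γ+H}) = ∑_{μ ∈ H} e^{γ+μ}`, as an element of `ℂ[D]`. -/
def liftVec {D : Type*} [AddCommGroup D] (H : AddSubgroup D) (γ : D) : D → ℂ :=
  fun β => if β - γ ∈ H then 1 else 0

/-- The sum `∑_{H ∈ S} im(↑_H)` of the images of the isotropic lifts
`↑_H : ℂ[H^⊥/H] → ℂ[D]` over a family `S` of isotropic subgroups of `D`:
it is spanned by the lifts of the basis vectors `e^{γ+H}`, `γ ∈ H^⊥`. -/
def imUpOn {D : Type*} [AddCommGroup D] (q : D → AddCircle (1 : ℚ))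
    (S : Set (AddSubgroup D)) : Submodule ℂ (D → ℂ) :=
  Submodule.span ℂ
    {v | ∃ H ∈ S, ∃ γ : D, (∀ μ ∈ H, bil q γ μ = 0) ∧ v = liftVec H γ}

/-- The intersection `∩_{H ∈ S} ker(↓_H)` of the kernels of the isotropic descents
`↓_H : ℂ[D] → ℂ[H^⊥/H]`: a vector `v` lies in `ker(↓_H)` iff for every `γ ∈ H^⊥`
the sum of `v` over the coset `γ + H` vanishes. -/
def kerDownOn {D : Type*} [AddCommGroup D] [Fintype D] (q : D → AddCircle (1 : ℚ))
    (S : Set (AddSubgroup D)) : Set (D → ℂ) :=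
  {v | ∀ H ∈ S, ∀ γ : D, (∀ μ ∈ H, bil q γ μ = 0) → ∑ μ : H, v (γ + (μ : D)) = 0}

/-- Summing over a subgroup `H` the sums over the cosets of a subgroup `K ≤ H` counts every
element of the coset of `H` exactly `|K|` times. -/
theorem sum_sum_add_of_le {D M : Type*} [AddCommGroup D] [Fintype D] [AddCommMonoid M]
    {K H : AddSubgroup D} (hKH : K ≤ H) (f : D → M) (γ : D) :
    ∑ μ : H, ∑ κ : K, f (γ + (μ : D) + (κ : D)) = Nat.card K • ∑ μ : H, f (γ + (μ : D)) := by
  rw [Finset.sum_comm]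
  have h (κ : K) : ∑ μ : H, f (γ + (μ : D) + (κ : D)) = ∑ μ : H, f (γ + (μ : D)) :=
    Fintype.sum_equiv (Equiv.addRight (⟨κ, hKH κ.2⟩ : H)) _ _ fun μ => by
      simp [add_assoc]
  simp [h, Nat.card_eq_fintype_card]

theorem liftVec_eq_sum_single {D : Type*} [AddCommGroup D] [Fintype D] (H : AddSubgroup D)
    (γ : D) : liftVec H γ = ∑ μ : H, Pi.single (γ + (μ : D)) (1 : ℂ) := by
  funext β
  simp only [liftVec, Finset.sum_apply, Pi.single_apply]
  by_cases h : β - γ ∈ H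
  · rw [if_pos h, Finset.sum_eq_single (⟨β - γ, h⟩ : H)]
    · simp
    · rintro ⟨μ, hμ⟩ _ hne
      refine if_neg fun hβ => hne (Subtype.ext ?_)
      simp [hβ]
    · simp
  · rw [if_neg h]
    refine (Finset.sum_eq_zero fun μ _ => if_neg fun hβ => h ?_).symm
    simp [hβ]

/-- Lifts are transitive: a multiple of the lift from `H^⊥/H` is a sum of lifts from `K^⊥/K`. -/
theorem sum_liftVec_of_le {D : Type*} [AddCommGroup D] [Fintype D] {K H : AddSubgroup D}
    (hKH : K ≤ H) (γ : D) :
    ∑ μ : H, liftVec K (γ + (μ : D)) = Nat.card K • liftVec H γ := by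
  simp only [liftVec_eq_sum_single]
  exact sum_sum_add_of_le hKH (fun x => Pi.single x (1 : ℂ)) γ

/-- A nontrivial finite group of `p`-power exponent has a subgroup of order `p`. -/
theorem exists_le_card_eq_prime {D : Type*} [AddCommGroup D] [Fintype D] {p : ℕ}
    (hp : p.Prime) (hexp : ∃ k : ℕ, ∀ x : D, p ^ k • x = 0) {H : AddSubgroup D} (hH : H ≠ ⊥) :
    ∃ K ≤ H, Nat.card K = p := by
  obtain ⟨k, hk⟩ := hexp
  obtain ⟨x, hxH, hx⟩ := H.bot_or_exists_ne_zero.resolve_left hH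
  obtain ⟨m, -, hm⟩ := (Nat.dvd_prime_pow hp).1 (addOrderOf_dvd_of_nsmul_eq_zero (hk x))
  have hm0 : m ≠ 0 := by
    rintro rfl
    exact hx (AddMonoid.addOrderOf_eq_one_iff.1 (by simpa using hm))
  have hdvd : p ∣ addOrderOf x := hm ▸ dvd_pow_self p hm0
  refine ⟨AddSubgroup.zmultiples ((addOrderOf x / p) • x), ?_, ?_⟩
  · exact (AddSubgroup.zmultiples_le_of_mem (H.nsmul_mem hxH _))
  · rw [Nat.card_zmultiples]
    exact addOrderOf_nsmul_addOrderOf_sub (addOrderOf_pos x).ne' hdvd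

theorem bil_add_eq_zero_of_isotropic {D : Type*} [AddCommGroup D] {q : D → AddCircle (1 : ℚ)}
    (hbil : ∀ x y z : D, bil q (x + y) z = bil q x z + bil q y z) {H : AddSubgroup D}
    (hq : ∀ x ∈ H, q x = 0) {γ μ ν : D} (hγ : ∀ ν ∈ H, bil q γ ν = 0) (hμ : μ ∈ H)
    (hν : ν ∈ H) : bil q (γ + μ) ν = 0 := by
  rw [hbil, hγ ν hν, zero_add, bil, hq _ (H.add_mem hμ hν), hq μ hμ, hq ν hν]
  simp

/-- Let `D` be a finite abelian group with a non-degenerate quadratic form of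
exponent a power of a prime `p`.  Let `𝓗` be the set of all nontrivial isotropic
subgroups of `D` and `𝓗'` the subset of those of order `p`.  Then
`∑_{H∈𝓗} im(↑_H) = ∑_{H∈𝓗'} im(↑_H)` and `∩_{H∈𝓗} ker(↓_H) = ∩_{H∈𝓗'} ker(↓_H)`. -/
theorem imUp_eq_imUp_orderP_and_kerDown_eq
    {D : Type*} [AddCommGroup D] [Fintype D] (p : ℕ) (hp : p.Prime)
    (q : D → AddCircle (1 : ℚ))
    (hquad : ∀ (n : ℤ) (x : D), q (n • x) = (n ^ 2 : ℤ) • q x)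
    (hbil : ∀ x y z : D, bil q (x + y) z = bil q x z + bil q y z)
    (hnd : ∀ x : D, (∀ y : D, bil q x y = 0) → x = 0)
    (hexp : ∃ k : ℕ, ∀ x : D, p ^ k • x = 0) :
    imUpOn q {H : AddSubgroup D | H ≠ ⊥ ∧ ∀ x ∈ H, q x = 0}
        = imUpOn q {H : AddSubgroup D | H ≠ ⊥ ∧ (∀ x ∈ H, q x = 0) ∧ Nat.card H = p} ∧
    kerDownOn q {H : AddSubgroup D | H ≠ ⊥ ∧ ∀ x ∈ H, q x = 0}
        = kerDownOn q {H : AddSubgroup D | H ≠ ⊥ ∧ (∀ x ∈ H, q x = 0) ∧ Nat.card H = p} := by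
  have key : ∀ H : AddSubgroup D, H ≠ ⊥ → (∀ x ∈ H, q x = 0) →
      ∃ K ≤ H, K ≠ ⊥ ∧ (∀ x ∈ K, q x = 0) ∧ Nat.card K = p := by
    intro H hH hq
    obtain ⟨K, hKH, hK⟩ := exists_le_card_eq_prime hp hexp hH
    refine ⟨K, hKH, ?_, fun x hx => hq x (hKH hx), hK⟩
    rintro rfl
    exact hp.ne_one (by simpa using hK.symm)
  have hp0 : (p : ℂ) ≠ 0 := Nat.cast_ne_zero.2 hp.ne_zero
  refine ⟨le_antisymm (Submodule.span_le.2 ?_) (Submodule.span_mono ?_),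
    Set.Subset.antisymm ?_ ?_⟩
  · rintro _ ⟨H, ⟨hH, hq⟩, γ, hγ, rfl⟩
    obtain ⟨K, hKH, hK⟩ := key H hH hq
    have hsum := sum_liftVec_of_le hKH γ
    rw [hK.2.2, ← Nat.cast_smul_eq_nsmul ℂ] at hsum
    rw [SetLike.mem_coe, ← Submodule.smul_mem_iff _ hp0, ← hsum]
    exact Submodule.sum_mem _ fun μ _ => Submodule.subset_span
      ⟨K, hK, _, fun ν hν => bil_add_eq_zero_of_isotropic hbil hq hγ μ.2 (hKH hν), rfl⟩
  · rintro _ ⟨H, hH, h⟩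
    exact ⟨H, ⟨hH.1, hH.2.1⟩, h⟩
  · exact fun v hv H hH => hv H ⟨hH.1, hH.2.1⟩
  · rintro v hv H ⟨hH, hq⟩ γ hγ
    obtain ⟨K, hKH, hK⟩ := key H hH hq
    have hsum := sum_sum_add_of_le hKH v γ
    rw [hK.2.2, nsmul_eq_mul, Finset.sum_eq_zero fun μ _ => hv K hK _ fun ν hν =>
      bil_add_eq_zero_of_isotropic hbil hq hγ μ.2 (hKH hν)] at hsum
    exact (mul_eq_zero.1 hsum.symm).resolve_left hp0
end
end

section
/- Let D be a finite abelian group with non-degenerate quadratic form, of exponent a power of a prime p, and let γ ∈ D. Assume γ^⊥ contains no isotropic subgroup isomorphic to (ℤ/pℤ)^2. Define v := e^γ − (1/(p−1)) Σ_{H'} Σ_{μ∈H'\{0}} e^{γ+μ}, where H' ranges over isotropic subgroups of order p contained in γ^⊥. Then ↓_H(v) = 0 for every nontrivial isotropic subgroup H ⊆ γ^⊥, and ⟨v, e^γ⟩ = 1. -/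
open scoped Classical BigOperators

noncomputable section

/-- The standard basis vector `e^γ` of `ℂ[D]`. -/
def eV {D : Type*} (γ : D) : D → ℂ := fun β => if β = γ then 1 else 0

/-- The set of isotropic elements of order `p` in `γ^⊥`. -/
def isotropicOrderP {D : Type*} [AddCommGroup D] (p : ℕ) (q : D → AddCircle (1 : ℚ)) (γ : D) :
    Set D :=
  {μ | μ ≠ 0 ∧ p • μ = 0 ∧ q μ = 0 ∧ bil q γ μ = 0}

lemma bil_comm {D : Type*} [AddCommGroup D] (q : D → AddCircle (1 : ℚ)) (x y : D) :
    bil q x y = bil q y x := by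
  simp only [bil, add_comm x y]
  abel

lemma bil_zsmul_left {D : Type*} [AddCommGroup D] {q : D → AddCircle (1 : ℚ)}
    (hbil : ∀ x y z : D, bil q (x + y) z = bil q x z + bil q y z) (n : ℤ) (x z : D) :
    bil q (n • x) z = n • bil q x z :=
  map_zsmul (AddMonoidHom.mk' (fun x => bil q x z) fun x y => hbil x y z) n x

lemma bil_zsmul_right {D : Type*} [AddCommGroup D] {q : D → AddCircle (1 : ℚ)}
    (hbil : ∀ x y z : D, bil q (x + y) z = bil q x z + bil q y z) (n : ℤ) (x z : D) :
    bil q x (n • z) = n • bil q x z := by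
  rw [bil_comm, bil_zsmul_left hbil, bil_comm]

lemma bil_add_right {D : Type*} [AddCommGroup D] {q : D → AddCircle (1 : ℚ)}
    (hbil : ∀ x y z : D, bil q (x + y) z = bil q x z + bil q y z) (x y z : D) :
    bil q x (y + z) = bil q x y + bil q x z := by
  rw [bil_comm, hbil, bil_comm q y, bil_comm q z]

lemma quad_add {D : Type*} [AddCommGroup D] (q : D → AddCircle (1 : ℚ)) (x y : D) :
    q (x + y) = bil q x y + q x + q y := by
  simp only [bil]
  abel

lemma mem_zmultiples_of_zsmul_mem {D : Type*} [AddCommGroup D] {p : ℕ} (hp : p.Prime)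
    {K : AddSubgroup D} {y : D} (hy : p • y = 0) {n : ℤ} (hn : ¬ (p : ℤ) ∣ n)
    (h : n • y ∈ K) : y ∈ K := by
  obtain ⟨a, b, hab⟩ := (Nat.prime_iff_prime_int.mp hp).coprime_iff_not_dvd.mpr hn
  have : y = b • (n • y) := by
    conv_lhs => rw [← one_zsmul y, ← hab, add_zsmul, mul_zsmul, mul_zsmul, natCast_zsmul, hy,
      zsmul_zero, zero_add]
  rw [this]
  exact K.zsmul_mem h b

lemma dvd_of_zsmul_eq_zero {D : Type*} [AddCommGroup D] {p : ℕ} (hp : p.Prime)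
    {y : D} (hy : p • y = 0) (hy0 : y ≠ 0) {n : ℤ} (h : n • y = 0) : (p : ℤ) ∣ n := by
  by_contra hn
  exact hy0 (by simpa using mem_zmultiples_of_zsmul_mem (K := ⊥) hp hy hn (by simpa using h))

/-- Two elements of order `p`, the second not a multiple of the first, span a copy of
`(ℤ/pℤ)²`. -/
lemma exists_subgroup_equiv_of_not_mem_zmultiples {D : Type*} [AddCommGroup D] {p : ℕ}
    (hp : p.Prime) {x y : D} (hx : p • x = 0) (hx0 : x ≠ 0) (hy : p • y = 0)
    (hxy : y ∉ AddSubgroup.zmultiples x) :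
    ∃ K : AddSubgroup D, (∀ z ∈ K, ∃ m n : ℤ, z = m • x + n • y) ∧
      Nonempty (K ≃+ (ZMod p × ZMod p)) := by
  let F : ∀ z : D, p • z = 0 → (ZMod p →+ D) := fun z hz =>
    ZMod.lift p ⟨(zmultiplesHom D) z, by simpa using hz⟩
  have hF : ∀ z hz (n : ℤ), F z hz n = n • z := fun z hz n => by simp [F]
  let f := (F x hx).coprod (F y hy)
  have hf : ∀ m n : ℤ, f ((m : ZMod p), (n : ZMod p)) = m • x + n • y := fun m n => by
    simp [f, hF]
  have hinj : Function.Injective f := by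
    rw [injective_iff_map_eq_zero]
    rintro ⟨a, b⟩ hab
    obtain ⟨m, rfl⟩ := ZMod.intCast_surjective a
    obtain ⟨n, rfl⟩ := ZMod.intCast_surjective b
    rw [hf] at hab
    have hn : (p : ℤ) ∣ n := by
      by_contra hn
      refine hxy (mem_zmultiples_of_zsmul_mem hp hy hn ?_)
      rw [eq_neg_of_add_eq_zero_right hab]
      exact neg_mem (AddSubgroup.zsmul_mem_zmultiples x m)
    have hny : n • y = 0 := by
      obtain ⟨c, rfl⟩ := hn
      rw [mul_comm, mul_zsmul, natCast_zsmul, hy, zsmul_zero]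
    have hm : (p : ℤ) ∣ m := dvd_of_zsmul_eq_zero hp hx hx0 (by simpa [hny] using hab)
    rw [(ZMod.intCast_zmod_eq_zero_iff_dvd m p).mpr hm,
      (ZMod.intCast_zmod_eq_zero_iff_dvd n p).mpr hn]
    rfl
  refine ⟨f.range, ?_, ⟨(AddMonoidHom.ofInjective hinj).symm⟩⟩
  rintro _ ⟨⟨a, b⟩, rfl⟩
  obtain ⟨m, rfl⟩ := ZMod.intCast_surjective a
  obtain ⟨n, rfl⟩ := ZMod.intCast_surjective b
  exact ⟨m, n, hf m n⟩

lemma mem_zmultiples_of_orthogonal {D : Type*} [AddCommGroup D] {p : ℕ} (hp : p.Prime)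
    {q : D → AddCircle (1 : ℚ)}
    (hquad : ∀ (n : ℤ) (x : D), q (n • x) = (n ^ 2 : ℤ) • q x)
    (hbil : ∀ x y z : D, bil q (x + y) z = bil q x z + bil q y z) {γ : D}
    (hno : ¬ ∃ K : AddSubgroup D, (∀ x ∈ K, q x = 0) ∧
      (∀ x ∈ K, bil q γ x = 0) ∧ Nonempty (K ≃+ (ZMod p × ZMod p)))
    {x y : D} (hx : x ∈ isotropicOrderP p q γ) (hy : y ∈ isotropicOrderP p q γ)
    (hxy : bil q x y = 0) : y ∈ AddSubgroup.zmultiples x := by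
  by_contra h
  obtain ⟨hx0, hpx, hqx, hγx⟩ := hx
  obtain ⟨-, hpy, hqy, hγy⟩ := hy
  obtain ⟨K, hK, e⟩ := exists_subgroup_equiv_of_not_mem_zmultiples hp hpx hx0 hpy h
  refine hno ⟨K, fun z hz => ?_, fun z hz => ?_, e⟩ <;> obtain ⟨m, n, rfl⟩ := hK z hz
  · simp [quad_add, bil_zsmul_left hbil, bil_zsmul_right hbil, hxy, hquad, hqx, hqy]
  · simp [bil_add_right hbil, bil_zsmul_right hbil, hγx, hγy]

lemma card_zmultiples_of_mem {D : Type*} [AddCommGroup D] {p : ℕ} (hp : p.Prime)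
    {q : D → AddCircle (1 : ℚ)} {γ x : D} (hx : x ∈ isotropicOrderP p q γ) :
    Nat.card (AddSubgroup.zmultiples x) = p := by
  have := Fact.mk hp
  rw [Nat.card_zmultiples]
  exact addOrderOf_eq_prime hx.2.1 hx.1

lemma zsmul_mem_isotropicOrderP {D : Type*} [AddCommGroup D] {p : ℕ}
    {q : D → AddCircle (1 : ℚ)}
    (hquad : ∀ (n : ℤ) (x : D), q (n • x) = (n ^ 2 : ℤ) • q x)
    (hbil : ∀ x y z : D, bil q (x + y) z = bil q x z + bil q y z) {γ x y : D}
    (hx : x ∈ isotropicOrderP p q γ) (hy : y ∈ AddSubgroup.zmultiples x) (hy0 : y ≠ 0) :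
    y ∈ isotropicOrderP p q γ := by
  obtain ⟨n, rfl⟩ := AddSubgroup.mem_zmultiples_iff.mp hy
  obtain ⟨-, hpx, hqx, hγx⟩ := hx
  refine ⟨hy0, ?_, ?_, ?_⟩
  · rw [smul_comm, hpx, smul_zero]
  · rw [hquad, hqx, smul_zero]
  · rw [bil_zsmul_right hbil, hγx, smul_zero]

/-- Every isotropic element of order `p` in `γ^⊥` lies in exactly one isotropic subgroup of
order `p` contained in `γ^⊥`. -/
lemma sum_isotropic_lines {D : Type*} [AddCommGroup D] [Fintype D] {p : ℕ} (hp : p.Prime)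
    {q : D → AddCircle (1 : ℚ)}
    (hquad : ∀ (n : ℤ) (x : D), q (n • x) = (n ^ 2 : ℤ) • q x)
    (hbil : ∀ x y z : D, bil q (x + y) z = bil q x z + bil q y z) (γ : D)
    {M : Type*} [AddCommMonoid M] (g : D → M) :
    ∑ᶠ H' ∈ {H : AddSubgroup D | Nat.card H = p ∧ (∀ x ∈ H, q x = 0) ∧
          ∀ x ∈ H, bil q γ x = 0},
        ∑ μ : H', (if (μ : D) = 0 then 0 else g μ) =
      ∑ μ : D, if μ ∈ isotropicOrderP p q γ then g μ else 0 := by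
  have hmem : ∀ H' : AddSubgroup D, Nat.card H' = p → ∀ x ∈ H', p • x = 0 := by
    intro H' hc x hx
    have := card_nsmul_eq_zero' (x := (⟨x, hx⟩ : H'))
    rw [hc] at this
    simpa using congrArg Subtype.val this
  rw [finsum_mem_eq_finite_toFinset_sum _ (Set.toFinite _)]
  have hsub : ∀ H' : AddSubgroup D, ∑ μ : H', (if (μ : D) = 0 then 0 else g μ) =
      ∑ μ : D, if μ ∈ H' then (if μ = 0 then 0 else g μ) else 0 := fun H' => by
    rw [← Finset.sum_filter]
    exact (Finset.sum_subtype _ (by simp) fun μ : D => if μ = 0 then 0 else g μ).symm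
  simp_rw [hsub]
  rw [Finset.sum_comm]
  refine Finset.sum_congr rfl fun μ _ => ?_
  split_ifs with h0 hμ hμ
  · exact absurd h0 hμ.1
  · simp
  · rw [Finset.sum_eq_single (AddSubgroup.zmultiples μ)]
    · simp
    · intro H' hH' hne
      rw [if_neg]
      intro hin
      simp only [Set.Finite.mem_toFinset, Set.mem_ofPred_eq] at hH'
      refine hne (AddSubgroup.eq_of_le_of_card_ge (AddSubgroup.zmultiples_le_of_mem hin) ?_).symm
      rw [hH'.1, card_zmultiples_of_mem hp hμ]
    · intro hn
      refine absurd ?_ hn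
      simp only [Set.Finite.mem_toFinset, Set.mem_ofPred_eq]
      refine ⟨card_zmultiples_of_mem hp hμ, fun x hx => ?_, fun x hx => ?_⟩ <;>
        obtain ⟨n, rfl⟩ := AddSubgroup.mem_zmultiples_iff.mp hx
      · rw [hquad, hμ.2.2.1, smul_zero]
      · rw [bil_zsmul_right hbil, hμ.2.2.2, smul_zero]
  · refine Finset.sum_eq_zero fun H' hH' => ?_
    simp only [Set.Finite.mem_toFinset, Set.mem_ofPred_eq] at hH'
    rw [if_neg]
    exact fun hin => hμ ⟨h0, hmem H' hH'.1 μ hin, hH'.2.1 μ hin, hH'.2.2 μ hin⟩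

lemma exists_order_p_mem {D : Type*} [AddCommGroup D] {p : ℕ}
    (hexp : ∃ k : ℕ, ∀ x : D, p ^ k • x = 0) {H : AddSubgroup D} (hH : H ≠ ⊥) :
    ∃ h ∈ H, h ≠ 0 ∧ p • h = 0 := by
  obtain ⟨x, hx, hx0⟩ := H.bot_or_exists_ne_zero.resolve_left hH
  obtain ⟨k, hk⟩ := hexp
  have hex : ∃ k : ℕ, p ^ k • x = 0 := ⟨k, hk x⟩
  obtain ⟨j, hj⟩ : ∃ j, Nat.find hex = j + 1 := Nat.exists_eq_succ_of_ne_zero fun h => hx0 <| by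
    simpa [h] using Nat.find_spec hex
  refine ⟨p ^ j • x, H.nsmul_mem hx _, Nat.find_min hex (by omega), ?_⟩
  rw [smul_smul, ← pow_succ', ← hj]
  exact Nat.find_spec hex

/-- Let `D` be a finite abelian group with non-degenerate quadratic form, of
exponent a power of a prime `p`, and let `γ ∈ D`.  Assume `γ^⊥` contains no
isotropic subgroup isomorphic to `(ℤ/pℤ)²`.  Define
`v := e^γ − (1/(p−1)) ∑_{H'} ∑_{μ∈H'∖{0}} e^{γ+μ}`, where `H'` ranges over the
isotropic subgroups of order `p` contained in `γ^⊥`.  Then `↓_H(v) = 0` for every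
nontrivial isotropic subgroup `H ⊆ γ^⊥` (i.e. all coset sums of `v` over cosets of
such `H` meeting `H^⊥` vanish), and `⟨v, e^γ⟩ = 1`. -/
theorem kernel_element_of_no_isotropic_rank_two
    {D : Type*} [AddCommGroup D] [Fintype D] (p : ℕ) (hp : p.Prime)
    (q : D → AddCircle (1 : ℚ))
    (hquad : ∀ (n : ℤ) (x : D), q (n • x) = (n ^ 2 : ℤ) • q x)
    (hbil : ∀ x y z : D, bil q (x + y) z = bil q x z + bil q y z)
    (hnd : ∀ x : D, (∀ y : D, bil q x y = 0) → x = 0)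
    (hexp : ∃ k : ℕ, ∀ x : D, p ^ k • x = 0)
    (γ : D)
    (hno : ¬ ∃ K : AddSubgroup D, (∀ x ∈ K, q x = 0) ∧
      (∀ x ∈ K, bil q γ x = 0) ∧ Nonempty (K ≃+ (ZMod p × ZMod p)))
    (v : D → ℂ)
    (hv : v = eV γ - ((p : ℂ) - 1)⁻¹ •
      ∑ᶠ H' ∈ {H : AddSubgroup D | Nat.card H = p ∧ (∀ x ∈ H, q x = 0) ∧
          ∀ x ∈ H, bil q γ x = 0},
        ∑ μ : H', if (μ : D) = 0 then 0 else eV (γ + (μ : D))) :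
    (∀ H : AddSubgroup D, H ≠ ⊥ → (∀ x ∈ H, q x = 0) → (∀ x ∈ H, bil q γ x = 0) →
      ∀ α : D, (∀ μ ∈ H, bil q α μ = 0) → ∑ μ : H, v (α + (μ : D)) = 0) ∧
    ∑ β : D, v β * star (eV γ β) = 1 := by
  have hpc : (p : ℂ) - 1 ≠ 0 := sub_ne_zero.mpr (by exact_mod_cast hp.one_lt.ne')
  have hvβ : ∀ β, v β = (if β = γ then 1 else 0) -
      ((p : ℂ) - 1)⁻¹ * if β - γ ∈ isotropicOrderP p q γ then 1 else 0 := by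
    intro β
    rw [hv, sum_isotropic_lines hp hquad hbil γ fun μ => eV (γ + μ)]
    simp only [Pi.sub_apply, Pi.smul_apply, smul_eq_mul, Finset.sum_apply]
    congr 2
    rw [Finset.sum_eq_single (β - γ)]
    · split_ifs <;> simp [eV]
    · intro μ _ hμ
      have : β ≠ γ + μ := fun h => hμ (by simp [h])
      split_ifs <;> simp [eV, this]
    · simp
  refine ⟨fun H hH hqH hγH α hα => ?_, ?_⟩
  · obtain ⟨h, hhH, hh0, hph⟩ := exists_order_p_mem hexp hH
    have hh : h ∈ isotropicOrderP p q γ := ⟨hh0, hph, hqH h hhH, hγH h hhH⟩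
    have hle : AddSubgroup.zmultiples h ≤ H := AddSubgroup.zmultiples_le_of_mem hhH
    have hHH : ∀ x ∈ H, bil q x h = 0 := fun x hx => by
      simp [bil, hqH x hx, hqH h hhH, hqH _ (H.add_mem hx hhH)]
    have key : ∀ y ∈ isotropicOrderP p q γ, bil q y h = 0 → y ∈ AddSubgroup.zmultiples h :=
      fun y hy hyh => mem_zmultiples_of_orthogonal hp hquad hbil hno hh hy (by rwa [bil_comm])
    by_cases hαγ : α - γ ∈ H
    · have hshift : ∑ μ : H, v (α + (μ : D)) = ∑ μ : H, v (γ + (μ : D)) :=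
        Fintype.sum_equiv (Equiv.addLeft (⟨α - γ, hαγ⟩ : H)) _ _ fun μ => by
          simp only [Equiv.coe_addLeft, AddSubgroup.coe_add]
          congr 1
          abel
      have hiff : ∀ μ : D, (μ ∈ H ∧ μ ∈ isotropicOrderP p q γ) ↔
          μ ∈ AddSubgroup.zmultiples h ∧ μ ≠ 0 := fun μ =>
        ⟨fun hμ => ⟨key μ hμ.2 (hHH μ hμ.1), hμ.2.1⟩,
          fun hμ => ⟨hle hμ.1, zsmul_mem_isotropicOrderP hquad hbil hh hμ.1 hμ.2⟩⟩
      have hcount : ∑ μ : H, (if (μ : D) ∈ isotropicOrderP p q γ then (1 : ℂ) else 0) =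
          (p : ℂ) - 1 := by
        have hcard : (Finset.univ.filter fun μ : D => μ ∈ AddSubgroup.zmultiples h).card = p := by
          rw [← Fintype.card_subtype, ← Nat.card_eq_fintype_card]
          exact card_zmultiples_of_mem hp hh
        have herase : (Finset.univ.filter fun μ : D => μ ∈ AddSubgroup.zmultiples h ∧ μ ≠ 0) =
            (Finset.univ.filter fun μ : D => μ ∈ AddSubgroup.zmultiples h).erase 0 := by
          ext μ
          simp [and_comm]
        refine (Finset.sum_subtype (p := (· ∈ H)) (Finset.univ.filter (· ∈ H)) (by simp)
          fun μ : D => if μ ∈ isotropicOrderP p q γ then (1 : ℂ) else 0).symm.trans ?_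
        rw [← Finset.sum_filter, Finset.filter_filter, Finset.sum_const, nsmul_eq_mul, mul_one]
        simp_rw [hiff]
        rw [herase, Finset.card_erase_of_mem (by simp), hcard, Nat.cast_sub hp.one_lt.le,
          Nat.cast_one]
      rw [hshift]
      simp only [hvβ, add_sub_cancel_left, Finset.sum_sub_distrib, ← Finset.mul_sum, hcount,
        inv_mul_cancel₀ hpc]
      simp
    · refine Finset.sum_eq_zero fun μ _ => ?_
      have hne : α + (μ : D) ≠ γ := fun e => hαγ <| by
        rw [← e, sub_add_cancel_left]
        exact H.neg_mem μ.2
      have hnP : α + (μ : D) - γ ∉ isotropicOrderP p q γ := fun hP => hαγ <| by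
        have horth : bil q (α + (μ : D) - γ) h = 0 := by
          have hs := hbil (α + (μ : D) - γ) γ h
          rw [sub_add_cancel, hbil, hα h hhH, hHH _ μ.2, hγH h hhH] at hs
          simpa using hs.symm
        have := H.sub_mem (hle (key _ hP horth)) μ.2
        rwa [show α + (μ : D) - γ - μ = α - γ by abel] at this
      simp [hvβ, hne, hnP]
  · rw [Finset.sum_eq_single γ]
    · simp [hvβ, eV, isotropicOrderP]
    · intro β _ hβ
      simp [eV, hβ]
    · simp
end
end

section
/- Let p be an odd prime. The only finite quadratic forms (D, q) with D ≅ (ℤ/pℤ)^n (n ≥ 0) and q non-degenerate that contain no nonzero isotropic element are: the trivial form, the rank-1 forms p^{±1}, and the rank-2 form p^{−ε2} with ε = ((−1)/p). -/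
open scoped Classical BigOperators
open Matrix

noncomputable section

/-- The homomorphism `ℤ/pℤ → ℚ/ℤ` sending `1` to `1/p`. -/
def zmodToCircle (p : ℕ) [Fact p.Prime] : ZMod p →+ AddCircle (1 : ℚ) :=
  ZMod.lift p ⟨zmultiplesHom _ ((1 / p : ℚ) : AddCircle (1 : ℚ)), by
    have hp : (p : ℚ) ≠ 0 := Nat.cast_ne_zero.2 (Fact.out : p.Prime).ne_zero
    rw [zmultiplesHom_apply, ← AddCircle.coe_zsmul, AddCircle.coe_eq_zero_iff]
    exact ⟨1, by simp [hp]⟩⟩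

theorem zmodToCircle_intCast (p : ℕ) [Fact p.Prime] (k : ℤ) :
    zmodToCircle p (k : ZMod p) = (((k : ℚ) / p : ℚ) : AddCircle (1 : ℚ)) := by
  rw [zmodToCircle, ZMod.lift_coe]
  change k • ((1 / p : ℚ) : AddCircle (1 : ℚ)) = _
  rw [← AddCircle.coe_zsmul, zsmul_eq_mul, mul_one_div]

theorem zmodToCircle_eq_val (p : ℕ) [Fact p.Prime] (a : ZMod p) :
    zmodToCircle p a = (((a.val : ℚ) / p : ℚ) : AddCircle (1 : ℚ)) := by
  have h := zmodToCircle_intCast p (a.val : ℤ)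
  rwa [Int.cast_natCast, ZMod.natCast_zmod_val, Int.cast_natCast] at h

theorem zmodToCircle_injective (p : ℕ) [Fact p.Prime] :
    Function.Injective (zmodToCircle p) := by
  have hp : (p : ℚ) ≠ 0 := Nat.cast_ne_zero.2 (Fact.out : p.Prime).ne_zero
  rw [injective_iff_map_eq_zero]
  intro a ha
  obtain ⟨k, rfl⟩ := ZMod.intCast_surjective a
  rw [zmodToCircle_intCast, AddCircle.coe_eq_zero_iff] at ha
  obtain ⟨n, hn⟩ := ha
  rw [zsmul_eq_mul, mul_one, eq_div_iff hp] at hn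
  rw [ZMod.intCast_zmod_eq_zero_iff_dvd]
  exact ⟨n, by rw [mul_comm]; exact_mod_cast hn.symm⟩

theorem exists_zmodToCircle_eq (p : ℕ) [Fact p.Prime] (y : AddCircle (1 : ℚ))
    (hy : (p : ℤ) • y = 0) : ∃ a : ZMod p, zmodToCircle p a = y := by
  have hp : (p : ℚ) ≠ 0 := Nat.cast_ne_zero.2 (Fact.out : p.Prime).ne_zero
  obtain ⟨r, rfl⟩ := QuotientAddGroup.mk_surjective y
  change (p : ℤ) • ((r : ℚ) : AddCircle (1 : ℚ)) = 0 at hy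
  rw [← AddCircle.coe_zsmul, AddCircle.coe_eq_zero_iff] at hy
  obtain ⟨n, hn⟩ := hy
  refine ⟨n, ?_⟩
  rw [zmodToCircle_intCast]
  congr 1
  rw [div_eq_iff hp]
  simpa [mul_comm] using hn

theorem prime_zsmul_quadratic_eq_zero {D : Type*} [AddCommGroup D] (p : ℕ) [Fact p.Prime]
    (hodd : p ≠ 2) (q : D → AddCircle (1 : ℚ))
    (hquad : ∀ (m : ℤ) (x : D), q (m • x) = (m ^ 2 : ℤ) • q x)
    (hbil : ∀ x y z : D, bil q (x + y) z = bil q x z + bil q y z)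
    (helem : ∀ x : D, p • x = 0) (x : D) : (p : ℤ) • q x = 0 := by
  have h0 : q 0 = 0 := by simpa using hquad 0 0
  have hsq : ((p : ℤ) ^ 2) • q x = 0 := by
    rw [← hquad, natCast_zsmul, helem, h0]
  have hself : bil q x x = (2 : ℤ) • q x := by
    rw [bil, ← two_zsmul, hquad]
    module
  have htwo : (2 * p : ℤ) • q x = 0 := by
    have h := map_nsmul (AddMonoidHom.mk' (fun y => bil q y x) fun y z => hbil y z x) p x
    simp only [AddMonoidHom.mk'_apply, helem, hself] at h
    rw [mul_comm, mul_smul, natCast_zsmul, ← h]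
    simp [bil, h0]
  obtain ⟨k, hk⟩ := (Fact.out : p.Prime).odd_of_ne_two hodd
  have hkz : (p : ℤ) = 2 * k + 1 := by exact_mod_cast hk
  have : (p : ℤ) = (p : ℤ) ^ 2 - k * (2 * p) := by
    linear_combination (-(p : ℤ)) * hkz
  rw [this, sub_smul, mul_smul, hsq, htwo, smul_zero, sub_zero]

/-- A `p`-torsion quadratic function with values in `ℚ/ℤ`, for `p` odd, comes from a quadratic
form over `ℤ/pℤ`. -/
theorem exists_quadraticForm_zmod {D : Type*} [AddCommGroup D] (p : ℕ) [Fact p.Prime]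
    [Module (ZMod p) D] (hodd : p ≠ 2) (q : D → AddCircle (1 : ℚ))
    (hquad : ∀ (m : ℤ) (x : D), q (m • x) = (m ^ 2 : ℤ) • q x)
    (hbil : ∀ x y z : D, bil q (x + y) z = bil q x z + bil q y z)
    (helem : ∀ x : D, p • x = 0) :
    ∃ Q : QuadraticForm (ZMod p) D, ∀ x, zmodToCircle p (Q x) = q x := by
  choose f hf using fun x => exists_zmodToCircle_eq p (q x)
    (prime_zsmul_quadratic_eq_zero p hodd q hquad hbil helem x)
  have hpolar (x y : D) : zmodToCircle p (QuadraticMap.polar f x y) = bil q x y := by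
    simp [QuadraticMap.polar, bil, hf]
  have hadd (x y z : D) :
      QuadraticMap.polar f (x + y) z = QuadraticMap.polar f x z + QuadraticMap.polar f y z := by
    apply zmodToCircle_injective p
    rw [map_add, hpolar, hpolar, hpolar, hbil]
  refine ⟨QuadraticMap.ofPolar f ?_ hadd ?_, hf⟩
  · intro a x
    obtain ⟨k, rfl⟩ := ZMod.intCast_surjective a
    apply zmodToCircle_injective p
    rw [hf, Int.cast_smul_eq_zsmul, hquad, ← hf, ← map_zsmul, zsmul_eq_mul, smul_eq_mul]
    congr 1
    push_cast
    ring
  · intro a x y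
    exact ZMod.map_smul (AddMonoidHom.mk' (fun z => QuadraticMap.polar f z y)
      fun z w => hadd z w y) a x

theorem exists_linearEquiv_weightedSumSquares_of_anisotropic {K V : Type*} [Field K]
    (h2 : (2 : K) ≠ 0) [AddCommGroup V] [Module K V] [FiniteDimensional K V]
    (Q : QuadraticForm K V) (hQ : Q.Anisotropic) :
    ∃ (n : ℕ) (w : Fin n → Kˣ) (E : (Fin n → K) ≃ₗ[K] V),
      (∀ x, Q (E x) = QuadraticMap.weightedSumSquares K w x) ∧
      (QuadraticMap.weightedSumSquares K w).Anisotropic := by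
  let : Invertible (2 : K) := invertibleOfNonzero h2
  obtain ⟨w, ⟨E⟩⟩ := QuadraticForm.equivalent_weightedSumSquares_units_of_nondegenerate' Q
    (QuadraticMap.separatingLeft_of_anisotropic Q hQ)
  refine ⟨_, w, E.symm.toLinearEquiv, E.symm.map_app, fun x hx => ?_⟩
  rw [← E.symm.map_app] at hx
  exact E.symm.toLinearEquiv.map_eq_zero_iff.1 (hQ _ hx)

theorem card_le_two_of_anisotropic_weightedSumSquares {K : Type*} [Field K] [Fintype K]
    (hK : ringChar K ≠ 2) {n : ℕ} (w : Fin n → Kˣ)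
    (h : (QuadraticMap.weightedSumSquares K w).Anisotropic) : n ≤ 2 := by
  by_contra! hn
  obtain ⟨m, rfl⟩ := Nat.exists_eq_add_of_le' (show 3 ≤ n by omega)
  open Polynomial in
  obtain ⟨a, b, hab⟩ := FiniteField.exists_root_sum_quadratic
    (f := C (w 0 : K) * X ^ 2) (g := C (w 1 : K) * X ^ 2 + C (w 2 : K))
    (degree_C_mul_X_pow 2 (w 0).ne_zero)
    (by compute_degree!) (FiniteField.odd_card_of_char_ne_two hK)
  have hz := h (Fin.cons a (Fin.cons b (Fin.cons 1 0))) (by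
    simp [QuadraticMap.weightedSumSquares_apply, Fin.sum_univ_succ, Units.smul_def]
    simp at hab
    linear_combination hab)
  have hz2 := congrFun hz (Fin.succ (Fin.succ 0))
  simp only [Fin.cons_succ, Fin.cons_zero, Pi.zero_apply] at hz2
  exact one_ne_zero hz2

theorem not_isSquare_of_anisotropic_weightedSumSquares {K : Type*} [Field K]
    (w : Fin 2 → Kˣ) (h : (QuadraticMap.weightedSumSquares K w).Anisotropic) :
    ¬ IsSquare (-(w 0 * w 1 : K)) := by
  rintro ⟨r, hr⟩
  have hz := h ![r, w 0] (by
    simp [QuadraticMap.weightedSumSquares_apply, Fin.sum_univ_succ, Units.smul_def]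
    linear_combination -(w 0 : K) * hr)
  exact (w 0).ne_zero (by simpa using congrFun hz 1)

/-- Let `p` be an odd prime.  The only finite quadratic forms `(D, q)` with
`D ≅ (ℤ/pℤ)ⁿ` (`n ≥ 0`) and `q` non-degenerate that contain no nonzero isotropic
element are: the trivial form, the rank-1 forms `p^{±1}`, and the rank-2 form
`p^{−ε2}` with `ε = ((−1)/p)`, i.e. the rank-2 form whose Gram determinant has
Legendre symbol `−((−1)/p)`. -/
theorem anisotropic_classification_odd_p
    {D : Type*} [AddCommGroup D] [Fintype D] (p : ℕ) [Fact p.Prime] (hodd : p ≠ 2)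
    (q : D → AddCircle (1 : ℚ))
    (hquad : ∀ (m : ℤ) (x : D), q (m • x) = (m ^ 2 : ℤ) • q x)
    (hbil : ∀ x y z : D, bil q (x + y) z = bil q x z + bil q y z)
    (hnd : ∀ x : D, (∀ y : D, bil q x y = 0) → x = 0)
    (helem : ∀ x : D, p • x = 0)
    (haniso : ∀ x : D, x ≠ 0 → q x ≠ 0) :
    Nat.card D = 1 ∨ Nat.card D = p ∨
      (Nat.card D = p ^ 2 ∧
        ∃ (e : (Fin 2 → ZMod p) ≃+ D) (B : Matrix (Fin 2) (Fin 2) (ZMod p)),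
          (∀ x y : Fin 2 → ZMod p,
            bil q (e x) (e y) =
              ((((x ⬝ᵥ B.mulVec y).val : ℚ) / (p : ℚ) : ℚ) : AddCircle (1 : ℚ))) ∧
          legendreSym p (B.det.val : ℤ) = -legendreSym p (-1)) := by
  have : Module (ZMod p) D := AddCommGroup.zmodModule helem
  obtain ⟨Q, hQ⟩ := exists_quadraticForm_zmod p hodd q hquad hbil helem
  have hanisoQ : Q.Anisotropic := by
    intro x hx
    by_contra hne
    exact haniso x hne (by rw [← hQ, hx, map_zero])
  have hchar : ringChar (ZMod p) ≠ 2 := by rwa [ZMod.ringChar_zmod_n]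
  have h2 : (2 : ZMod p) ≠ 0 := Ring.two_ne_zero hchar
  obtain ⟨n, w, E, hE, hw⟩ := exists_linearEquiv_weightedSumSquares_of_anisotropic h2 Q hanisoQ
  have hcard : Nat.card D = p ^ n := by
    rw [← Nat.card_congr E.toEquiv]
    simp
  have hn := card_le_two_of_anisotropic_weightedSumSquares hchar w hw
  interval_cases n
  · exact Or.inl (by simpa using hcard)
  · exact Or.inr (Or.inl (by simpa using hcard))
  refine Or.inr (Or.inr ⟨hcard, E.toAddEquiv,
    !![2 * (w 0 : ZMod p), 0; 0, 2 * (w 1 : ZMod p)], ?_, ?_⟩)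
  · intro x y
    change bil q (E x) (E y) = _
    rw [← zmodToCircle_eq_val, bil, ← map_add, ← hQ, ← hQ, ← hQ, ← map_sub, ← map_sub, hE, hE, hE]
    congr 1
    simp [QuadraticMap.weightedSumSquares_apply, Fin.sum_univ_succ, Units.smul_def,
      Matrix.mulVec, dotProduct]
    ring
  · have hdet : (!![2 * (w 0 : ZMod p), 0; 0, 2 * (w 1 : ZMod p)]).det
        = 2 ^ 2 * (-1) * (-(w 0 * w 1 : ZMod p)) := by
      rw [Matrix.det_fin_two_of]
      ring
    have hns := quadraticChar_neg_one_iff_not_isSquare.2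
      (not_isSquare_of_anisotropic_weightedSumSquares w hw)
    simp only [legendreSym, Int.cast_natCast, ZMod.natCast_zmod_val]
    rw [hdet, map_mul, map_mul, quadraticChar_sq_one' h2, hns]
    simp
end
end

section
/- Let p be an odd prime and (D,q) a non-degenerate quadratic form on D ≅ (ℤ/pℤ)^4 of type p^{−4} (Gram determinant a non-square times appropriate sign, the unique rank-4 form of level p containing no isotropic subgroup isomorphic to (ℤ/pℤ)^2). Then for every β ∈ D there exists a nonzero isotropic element μ ∈ D with b(β, μ) = 0. -/
open scoped Classical BigOperators

noncomputable section

/-- By Chevalley–Warning, a bilinear form on a space of dimension at least `3` over a finite field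
has a nonzero isotropic vector. -/
theorem exists_ne_zero_bilin_self_eq_zero {K V : Type*} [Field K] [Fintype K] [AddCommGroup V]
    [Module K V] [FiniteDimensional K V] (hV : 3 ≤ Module.finrank K V) (B : V →ₗ[K] V →ₗ[K] K) :
    ∃ v : V, v ≠ 0 ∧ B v v = 0 := by
  let e := Module.finBasis K V
  let f : MvPolynomial (Fin (Module.finrank K V)) K :=
    ∑ i, ∑ j, MvPolynomial.C (B (e i) (e j)) * (MvPolynomial.X i * MvPolynomial.X j)
  have hf (x) : MvPolynomial.eval x f = B (∑ i, x i • e i) (∑ i, x i • e i) := by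
    simp only [f, map_sum, map_mul, MvPolynomial.eval_C, MvPolynomial.eval_X, map_smul,
      LinearMap.sum_apply, LinearMap.smul_apply, smul_eq_mul, Finset.mul_sum]
    rw [Finset.sum_comm]
    exact Finset.sum_congr rfl fun i _ => Finset.sum_congr rfl fun j _ => by ring
  have hdeg : f.totalDegree ≤ 2 := by
    refine MvPolynomial.totalDegree_finsetSum_le fun i _ =>
      MvPolynomial.totalDegree_finsetSum_le fun j _ => ?_
    refine (MvPolynomial.totalDegree_mul _ _).trans ?_
    have := MvPolynomial.totalDegree_mul (MvPolynomial.X (R := K) i) (MvPolynomial.X j)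
    simp only [MvPolynomial.totalDegree_X, MvPolynomial.totalDegree_C] at this ⊢
    omega
  obtain ⟨p, hchar⟩ := CharP.exists K
  have hp : p.Prime := (CharP.char_is_prime_or_zero K p).resolve_right
    (CharP.char_ne_zero_of_finite K p)
  have hdvd := char_dvd_card_solutions p (f := f) (by rw [Fintype.card_fin]; omega)
  let z : {x : Fin (Module.finrank K V) → K // MvPolynomial.eval x f = 0} := ⟨0, by rw [hf]; simp⟩
  have hone := hp.one_lt.trans_le (Nat.le_of_dvd (Fintype.card_pos_iff.mpr ⟨z⟩) hdvd)
  obtain ⟨x, hx⟩ := Fintype.exists_ne_of_one_lt_card hone z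
  refine ⟨∑ i, x.1 i • e i, fun h => hx (Subtype.ext (funext ?_)), (hf _).symm.trans x.2⟩
  exact Fintype.linearIndependent_iff.mp e.linearIndependent x.1 h

/-- Every `p`-torsion element of `ℚ/ℤ` lies in the image of an embedding of `ℤ/pℤ`. -/
theorem exists_zmod_embedding_addCircle (p : ℕ) [NeZero p] :
    ∃ φ : ZMod p →+ AddCircle (1 : ℚ), Function.Injective φ ∧
      ∀ t, p • t = 0 → ∃ k, φ k = t := by
  have hord := AddCircle.addOrderOf_period_div (p := (1 : ℚ)) (NeZero.pos p)
  refine ⟨ZMod.lift p ⟨zmultiplesHom _ (((1 : ℚ) / p : ℚ) : AddCircle (1 : ℚ)), ?_⟩, ?_, ?_⟩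
  · rw [zmultiplesHom_apply, natCast_zsmul, ← addOrderOf_dvd_iff_nsmul_eq_zero, hord]
  · rw [ZMod.lift_injective]
    intro m hm
    rw [zmultiplesHom_apply, ← addOrderOf_dvd_iff_zsmul_eq_zero, hord] at hm
    exact (ZMod.intCast_zmod_eq_zero_iff_dvd m p).mpr hm
  · intro t ht
    induction t using QuotientAddGroup.induction_on with
    | H r =>
      obtain ⟨n, hn⟩ := (AddCircle.coe_eq_zero_iff (1 : ℚ) (x := p • r)).mp ht
      refine ⟨n, ?_⟩
      rw [ZMod.lift_coe, zmultiplesHom_apply, ← AddCircle.coe_zsmul]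
      congr 1
      have hp0 : (p : ℚ) ≠ 0 := NeZero.ne _
      simp only [zsmul_eq_mul, nsmul_eq_mul, mul_one] at hn ⊢
      field_simp
      linarith

/-- Let `p` be an odd prime and `(D, q)` a non-degenerate quadratic form on
`D ≅ (ℤ/pℤ)⁴` of type `p^{−4}`, characterized as the rank-4 form of level `p`
containing no isotropic subgroup isomorphic to `(ℤ/pℤ)²` (while nonzero isotropic
elements exist).  Then for every `β ∈ D` there exists a nonzero isotropic
`μ ∈ D` with `b(β, μ) = 0`. -/
theorem exists_isotropic_orthogonal_in_p_minus_four
    {D : Type*} [AddCommGroup D] [Fintype D] (p : ℕ) (hp : p.Prime) (hodd : p ≠ 2)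
    (q : D → AddCircle (1 : ℚ))
    (hquad : ∀ (m : ℤ) (x : D), q (m • x) = (m ^ 2 : ℤ) • q x)
    (hbil : ∀ x y z : D, bil q (x + y) z = bil q x z + bil q y z)
    (hnd : ∀ x : D, (∀ y : D, bil q x y = 0) → x = 0)
    (helem : ∀ x : D, p • x = 0)
    (hcard : Nat.card D = p ^ 4)
    (hiso1 : ∃ μ : D, μ ≠ 0 ∧ q μ = 0)
    (hno2 : ¬ ∃ H : AddSubgroup D, (∀ x ∈ H, q x = 0) ∧
      Nonempty (H ≃+ (ZMod p × ZMod p))) :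
    ∀ β : D, ∃ μ : D, μ ≠ 0 ∧ q μ = 0 ∧ bil q β μ = 0 := by
  have : Fact p.Prime := ⟨hp⟩
  have : Module (ZMod p) D := AddCommGroup.zmodModule helem
  obtain ⟨φ, hφ, hsurj⟩ := exists_zmod_embedding_addCircle p
  have hcomm (x y : D) : bil q x y = bil q y x := by
    simp only [bil, add_comm x y]
    abel
  have hq0 : q 0 = 0 := by simpa using hquad 0 0
  have htor (x y : D) : p • bil q x y = 0 := by
    have h := map_nsmul (AddMonoidHom.mk' (fun x => bil q x y) fun a b => hbil a b y) p x
    simp only [AddMonoidHom.mk'_apply, helem] at h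
    rw [← h]
    simp [bil, hq0]
  choose b hb using fun x y => hsurj _ (htor x y)
  have hadd (x y z : D) : b (x + y) z = b x z + b y z :=
    hφ (by rw [map_add, hb, hb, hb, hbil])
  have hsymm (x y : D) : b x y = b y x := hφ (by rw [hb, hb, hcomm])
  have hsmul (c : ZMod p) (x y : D) : b (c • x) y = c • b x y :=
    ZMod.map_smul (AddMonoidHom.mk' (fun x => b x y) fun x z => hadd x z y) c x
  let B : D →ₗ[ZMod p] D →ₗ[ZMod p] ZMod p := LinearMap.mk₂ (ZMod p) b hadd hsmul
    (fun x y z => by rw [hsymm, hadd, hsymm y, hsymm z])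
    (fun c x y => by rw [hsymm, hsmul, hsymm y])
  have hdim : Module.finrank (ZMod p) D = 4 := by
    have h := Module.natCard_eq_pow_finrank (K := ZMod p) (V := D)
    rw [hcard, Nat.card_zmod] at h
    exact (Nat.pow_right_injective hp.two_le h).symm
  intro β
  have hker : 3 ≤ Module.finrank (ZMod p) (LinearMap.ker (B β)) := by
    have h := LinearMap.finrank_range_add_finrank_ker (B β)
    have hr := Submodule.finrank_le (LinearMap.range (B β))
    rw [Module.finrank_self] at hr
    omega
  obtain ⟨⟨μ, hμ⟩, hne, hiso⟩ :=
    exists_ne_zero_bilin_self_eq_zero hker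
      (B.domRestrict₁₂ (LinearMap.ker (B β)) (LinearMap.ker (B β)))
  refine ⟨μ, fun h => hne (Subtype.ext h), ?_, ?_⟩
  · have hself : bil q μ μ = 0 := by
      rw [← hb, show b μ μ = 0 from hiso, map_zero]
    have h2 : 2 • q μ = 0 := by
      have h := hquad 2 μ
      rw [two_zsmul] at h
      rw [bil, h] at hself
      rw [← hself]
      norm_num
      abel
    have hp2 : (p ^ 2) • q μ = 0 := by
      have h := hquad p μ
      rw [natCast_zsmul, helem, hq0] at h
      exact_mod_cast h.symm
    have hcop : Nat.Coprime 2 (p ^ 2) :=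
      ((Nat.coprime_primes Nat.prime_two hp).mpr hodd.symm).pow_right 2
    rw [← AddMonoid.addOrderOf_eq_one_iff, ← Nat.dvd_one, ← hcop]
    exact Nat.dvd_gcd (addOrderOf_dvd_of_nsmul_eq_zero h2) (addOrderOf_dvd_of_nsmul_eq_zero hp2)
  · rw [← hb, show b β μ = 0 from hμ, map_zero]
end
end

section
/- Let D be a discriminant form of exponent a power of 2, γ ∈ D, and suppose (γ_0, γ_1, ..., γ_{n−1}) is an isotropic cycle in G_D of odd length n with γ_0 = γ (indices mod n; each difference μ_i = γ_i − γ_{i−1} has order 2, is isotropic, and is orthogonal to both endpoints). If γ^⊥ contains an isotropic subgroup isomorphic to (ℤ/2ℤ)^2, or more generally if such an odd cycle of length 3 exists, then e^γ = −(1/2) Σ_{i=1}^{n} (−1)^i ↑_{⟨μ_i⟩}(e^{γ_i + ⟨μ_i⟩}) when n is odd; in particular e^γ ∈ im(↑). -/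
open scoped Classical BigOperators

noncomputable section

/-- `im(↑) = ∑_H im(↑_H)`, the span of all isotropic lifts over nontrivial
isotropic subgroups `H` of `D`. -/
def imUp {D : Type*} [AddCommGroup D] (q : D → AddCircle (1 : ℚ)) :
    Submodule ℂ (D → ℂ) :=
  Submodule.span ℂ
    {v | ∃ H : AddSubgroup D, H ≠ ⊥ ∧ (∀ x ∈ H, q x = 0) ∧
      ∃ γ : D, (∀ μ ∈ H, bil q γ μ = 0) ∧ v = liftVec H γ}

theorem mem_zmultiples_iff_of_two_nsmul_eq_zero {D : Type*} [AddCommGroup D] {μ : D}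
    (hμ : 2 • μ = 0) (x : D) : x ∈ AddSubgroup.zmultiples μ ↔ x = 0 ∨ x = μ := by
  constructor
  · rintro ⟨m, rfl⟩
    have hμ' : (2 : ℤ) • μ = 0 := by exact_mod_cast hμ
    obtain ⟨k, rfl | rfl⟩ := Int.even_or_odd' m
    · left
      simp [mul_comm (2 : ℤ) k, mul_zsmul, hμ']
    · right
      simp [mul_comm (2 : ℤ) k, mul_zsmul, add_zsmul, hμ']
  · rintro (rfl | rfl)
    · exact zero_mem _
    · exact AddSubgroup.mem_zmultiples _

theorem liftVec_zmultiples_sub {D : Type*} [AddCommGroup D] {a b : D} (hne : b - a ≠ 0)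
    (h2 : 2 • (b - a) = 0) :
    liftVec (AddSubgroup.zmultiples (b - a)) a = eV a + eV b := by
  have hab : a ≠ b := fun h => hne (sub_eq_zero.2 h.symm)
  funext β
  simp only [liftVec, eV, Pi.add_apply, mem_zmultiples_iff_of_two_nsmul_eq_zero h2,
    sub_eq_zero, sub_left_inj]
  by_cases ha : β = a
  · subst ha
    simp [hab]
  · simp [ha]

/-- The endpoints of an edge of the isotropic graph sum to an isotropic lift. -/
theorem eV_add_eV_mem_imUp {D : Type*} [AddCommGroup D] {q : D → AddCircle (1 : ℚ)}
    (hq0 : q 0 = 0) {a b : D} (hne : b - a ≠ 0) (h2 : 2 • (b - a) = 0)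
    (hq : q (b - a) = 0) (hb : bil q (b - a) a = 0) : eV a + eV b ∈ imUp q := by
  refine Submodule.subset_span ⟨AddSubgroup.zmultiples (b - a), ?_, ?_, a, ?_, ?_⟩
  · rwa [Ne, AddSubgroup.zmultiples_eq_bot]
  · intro x hx
    rcases (mem_zmultiples_iff_of_two_nsmul_eq_zero h2 x).1 hx with rfl | rfl
    · exact hq0
    · exact hq
  · intro x hx
    rcases (mem_zmultiples_iff_of_two_nsmul_eq_zero h2 x).1 hx with rfl | rfl
    · simp [bil, hq0]
    · rw [← hb, bil, bil, add_comm, sub_right_comm]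
  · exact (liftVec_zmultiples_sub hne h2).symm

theorem sum_range_alternating_add_succ {M : Type*} [AddCommGroup M] [Module ℂ M]
    (f : ℕ → M) (n : ℕ) :
    ∑ j ∈ Finset.range n, ((-1 : ℂ) ^ (j + 1)) • (f j + f (j + 1)) =
      ((-1 : ℂ) ^ n) • f n - f 0 := by
  induction n with
  | zero => simp
  | succ n ih =>
    rw [Finset.sum_range_succ, ih, pow_succ]
    module

/-- Let `D` be a discriminant form of exponent a power of `2`, `γ ∈ D`, and
suppose `(γ_0, γ_1, …, γ_{n−1})` is an isotropic cycle in `G_D` of odd length `n`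
with `γ_0 = γ`: each difference `μ_j = γ_{j+1} − γ_j` (indices mod `n`) has order
`2`, is isotropic, and is orthogonal to both endpoints.  Then
`e^γ = −(1/2) ∑_j (−1)^{j+1} ↑_{⟨μ_j⟩}(e^{γ_j})`, where
`↑_{⟨μ_j⟩}(e^{γ_j}) = e^{γ_j} + e^{γ_{j+1}}`; in particular `e^γ ∈ im(↑)`. -/
theorem basisVec_eq_alternating_lift_sum_of_odd_cycle
    {D : Type*} [AddCommGroup D] [Fintype D]
    (q : D → AddCircle (1 : ℚ))
    (hquad : ∀ (m : ℤ) (x : D), q (m • x) = (m ^ 2 : ℤ) • q x)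
    (hbil : ∀ x y z : D, bil q (x + y) z = bil q x z + bil q y z)
    (hnd : ∀ x : D, (∀ y : D, bil q x y = 0) → x = 0)
    (hexp : ∃ k : ℕ, ∀ x : D, 2 ^ k • x = 0)
    (γ : D) (n : ℕ) (hn : Odd n) (c : ZMod n → D) (hc0 : c 0 = γ)
    (hcyc : ∀ j : ZMod n,
      c (j + 1) - c j ≠ 0 ∧
      2 • (c (j + 1) - c j) = 0 ∧
      q (c (j + 1) - c j) = 0 ∧
      bil q (c (j + 1) - c j) (c j) = 0 ∧
      bil q (c (j + 1) - c j) (c (j + 1)) = 0) :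
    eV γ = (-(1 / 2) : ℂ) •
        ∑ j : Fin n, ((-1 : ℂ) ^ (j.val + 1)) •
          (eV (c (j.val : ZMod n)) + eV (c ((j.val : ZMod n) + 1))) ∧
      eV γ ∈ imUp q := by
  have key : eV γ = (-(1 / 2) : ℂ) •
      ∑ j : Fin n, ((-1 : ℂ) ^ (j.val + 1)) •
        (eV (c (j.val : ZMod n)) + eV (c ((j.val : ZMod n) + 1))) := by
    have hsum := sum_range_alternating_add_succ (fun j : ℕ => eV (c (j : ZMod n))) n
    simp only [Nat.cast_add, Nat.cast_one, ZMod.natCast_self, Nat.cast_zero, hc0,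
      hn.neg_one_pow] at hsum
    rw [Fin.sum_univ_eq_sum_range (fun j : ℕ => ((-1 : ℂ) ^ (j + 1)) •
      (eV (c (j : ZMod n)) + eV (c ((j : ZMod n) + 1)))) n, hsum]
    module
  refine ⟨key, ?_⟩
  rw [key]
  refine Submodule.smul_mem _ _ (Submodule.sum_mem _ fun j _ => Submodule.smul_mem _ _ ?_)
  obtain ⟨hne, h2, hq, hb, -⟩ := hcyc (j.val : ZMod n)
  exact eV_add_eV_mem_imUp (by simpa using hquad 0 0) hne h2 hq hb
end
end
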